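/- arXiv:2012.02668 — 2 statements merged into one kernel-verified Lean document; each statement's English description precedes it below -/
import Mathlib

section
/- There is no pertinent group of order 2^n·d with d odd and n ≥ 3 odd. Equivalently, if G is a finite group with exactly three pairwise-conjugate involutions and |G| = 2^n·d with d odd and n ≥ 2, then n is even. -/
/-- A finite group is *pertinent* if it has exactly three involutions and
they are pairwise conjugate. -/
def Pertinent (G : Type*) [Group G] : Prop :=
  Finite G ∧ {g : G | orderOf g = 2}.ncard = 3 ∧
    ∀ a b : G, orderOf a = 2 → orderOf b = 2 → IsConj a b

lemma perm3_fpf : ∀ A B : Equiv.Perm (Fin 3), A 0 = 1 → B 0 = 2 →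
    (∀ i, A i ≠ i) ∨ (∀ i, B i ≠ i) ∨ (∀ i, (A * B) i ≠ i) := by decide

lemma perm3_cube : ∀ A : Equiv.Perm (Fin 3), Equiv.Perm.sign A = 1 → A ^ 3 = 1 := by decide

lemma perm3_sign : ∀ A : Equiv.Perm (Fin 3), (∀ i, A i ≠ i) → Equiv.Perm.sign A = 1 := by decide

lemma perm3_sq : ∀ A : Equiv.Perm (Fin 3), (∀ i, A i ≠ i) → ∀ i, (A ^ 2) i ≠ i := by decide

lemma perm3_pow (A : Equiv.Perm (Fin 3)) (hA : ∀ i, A i ≠ i) (m : ℕ) (hm : ¬ 3 ∣ m) :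
    ∀ i, (A ^ m) i ≠ i := by
  have h3 := perm3_cube A (perm3_sign A hA)
  have : A ^ m = A ^ (m % 3) := by
    conv_lhs => rw [← Nat.div_add_mod m 3, pow_add, pow_mul, h3, one_pow, one_mul]
  rw [this]
  have h : m % 3 = 1 ∨ m % 3 = 2 := by omega
  rcases h with h | h <;> rw [h]
  · simpa using hA
  · exact perm3_sq A hA

lemma exists_p_part {G : Type*} [Group G] [Finite G] (p : ℕ) (hp : p.Prime) (g : G) :
    ∃ m k : ℕ, ¬ p ∣ m ∧ (g ^ m) ^ (p ^ k) = 1 := by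
  obtain ⟨k, m, hm, h⟩ := Nat.exists_eq_pow_mul_and_not_dvd (orderOf_pos g).ne' p hp.ne_one
  refine ⟨m, k, hm, ?_⟩
  rw [← pow_mul, mul_comm, ← h, pow_orderOf_eq_one]

lemma isPGroup_zpowers_of {G : Type*} [Group G] {p k : ℕ} {g : G} (h : g ^ (p ^ k) = 1) :
    IsPGroup p (Subgroup.zpowers g) := by
  apply IsPGroup.of_card_dvd_pow (n := k)
  rw [Nat.card_zpowers]
  exact orderOf_dvd_of_pow_eq_one h

lemma pow_two_three {G : Type*} [Group G] {x : G} {j k : ℕ} (h2 : x ^ (2 ^ j) = 1)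
    (h3 : x ^ (3 ^ k) = 1) : x = 1 := by
  have hc : Nat.Coprime (2 ^ j) (3 ^ k) := Nat.Coprime.pow _ _ (by norm_num)
  have := Nat.dvd_gcd (orderOf_dvd_of_pow_eq_one h2) (orderOf_dvd_of_pow_eq_one h3)
  rw [hc] at this
  exact orderOf_eq_one_iff.mp (Nat.dvd_one.mp this)

/-- With a normal 2-subgroup on which 3-cycles act without fixed points. -/
lemma card_mod_three {H : Type*} [Group H] [Finite H] (φ : H →* Equiv.Perm (Fin 3))
    (Q : Subgroup H) [Q.Normal]
    (hfix : ∀ g : H, (∀ i, φ g i ≠ i) → ∀ x ∈ Q, g * x = x * g → x = 1)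
    (g : H) (hg : ∀ i, φ g i ≠ i) : Nat.card Q ≡ 1 [MOD 3] := by
  have : Fact (Nat.Prime 3) := ⟨Nat.prime_three⟩
  obtain ⟨m, k, hm, hk⟩ := exists_p_part 3 Nat.prime_three g
  have hR := isPGroup_zpowers_of hk
  set r := g ^ m with hr
  have hφr : ∀ i, φ r i ≠ i := by
    rw [hr, map_pow]; exact perm3_pow _ hg m hm
  let : MulAction (Subgroup.zpowers r) Q :=
    MulAction.compHom Q ((MulAut.conjNormal (H := Q)).comp (Subgroup.zpowers r).subtype)
  have h := hR.card_modEq_card_fixedPoints Q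
  have h1 : Nat.card (MulAction.fixedPoints (Subgroup.zpowers r) Q) = 1 := by
    rw [Nat.card_eq_one_iff_unique]
    constructor
    · constructor
      have key : ∀ a : MulAction.fixedPoints (Subgroup.zpowers r) Q, (a : Q) = 1 := by
        intro a
        have ha := a.2 ⟨r, Subgroup.mem_zpowers r⟩
        have ha' : r * ((a : Q) : H) * r⁻¹ = ((a : Q) : H) := by
          have := congrArg (Subtype.val : Q → H) ha
          rw [← MulAut.conjNormal_apply]
          exact this
        apply Subtype.ext
        exact hfix r hφr _ (a : Q).2 (mul_inv_eq_iff_eq_mul.mp ha')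
      intro a b
      apply Subtype.ext
      rw [key a, key b]
    · exact ⟨⟨1, fun x => map_one (MulAut.conjNormal (H := Q) (x : H))⟩⟩
  rwa [h1] at h

lemma exists_odd_involution {H : Type*} [Group H] [Finite H] (φ : H →* Equiv.Perm (Fin 3))
    (Q : Subgroup H) [Q.Normal] (hQ2 : IsPGroup 2 Q)
    (hQ : ∀ (x : H) (k : ℕ), φ x = 1 → x ^ (2 ^ k) = 1 → x ∈ Q)
    (hfix : ∀ g : H, (∀ i, φ g i ≠ i) → ∀ x ∈ Q, g * x = x * g → x = 1)
    (g : H) (hg : ∀ i, φ g i ≠ i) (s : H) (hs : Equiv.Perm.sign (φ s) = -1) :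
    ∃ t : H, t ^ 2 = 1 ∧ Equiv.Perm.sign (φ t) = -1 := by
  have : Fact (Nat.Prime 3) := ⟨Nat.prime_three⟩
  obtain ⟨m, k, hm, hk⟩ := exists_p_part 3 Nat.prime_three g
  set r := g ^ m with hr
  have hφr : ∀ i, φ r i ≠ i := by
    rw [hr, map_pow]; exact perm3_pow _ hg m hm
  set ψ : H →* ℤˣ := Equiv.Perm.sign.comp φ with hψ
  have hψa : ∀ x, ψ x = Equiv.Perm.sign (φ x) := fun x => rfl
  have hrK : r ∈ ψ.ker := by
    rw [MonoidHom.mem_ker, hψa]; exact perm3_sign _ hφr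
  let r' : ψ.ker := ⟨r, hrK⟩
  have hk' : r' ^ (3 ^ k) = 1 := Subtype.ext (by simpa [r'] using hk)
  obtain ⟨P, hP⟩ := (isPGroup_zpowers_of hk').exists_le_sylow
  have hfr := P.normalizer_sup_eq_top
  set R : Subgroup H := (P : Subgroup ψ.ker).map ψ.ker.subtype with hRdef
  have hR3 : IsPGroup 3 R := P.2.map _
  have hrR : r ∈ R := ⟨r', hP (Subgroup.mem_zpowers r'), rfl⟩
  have hsT : s ∈ Subgroup.normalizer (R : Set H) ⊔ ψ.ker := by
    rw [hfr]; trivial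
  obtain ⟨n, hn, c, hc, rfl⟩ := Subgroup.mem_sup_of_normal_right.mp hsT
  have hψn : ψ n = -1 := by
    rw [← hψa, map_mul, MonoidHom.mem_ker.mp hc, mul_one] at hs
    exact hs
  obtain ⟨a, j, ha, hj⟩ := exists_p_part 2 Nat.prime_two n
  set t := n ^ a with ht
  have hψt : ψ t = -1 := by
    rw [ht, map_pow, hψn]
    exact Odd.neg_one_pow (Nat.not_even_iff_odd.mp (fun h => ha h.two_dvd))
  have htN : t ^ 2 ∈ Subgroup.normalizer (R : Set H) := pow_mem (pow_mem hn a) 2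
  have ht2 : (t ^ 2) ^ (2 ^ j) = 1 := by
    rw [← pow_mul, mul_comm, pow_mul, hj, one_pow]
  have hφt : φ (t ^ 2) = 1 := by
    apply pow_two_three (j := j) (k := 1)
    · rw [← map_pow, ht2, map_one]
    · apply perm3_cube
      rw [← hψa, map_pow, hψt]; simp
  have htQ : t ^ 2 ∈ Q := hQ _ j hφt ht2
  refine ⟨t, ?_, hψt⟩
  apply hfix r hφr _ htQ
  set u := t ^ 2
  -- the commutator lies in both subgroups
  have hcR : u * r * u⁻¹ * r⁻¹ ∈ R :=
    R.mul_mem ((Subgroup.mem_normalizer_iff.mp htN r).mp hrR) (R.inv_mem hrR)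
  have hcQ : u * r * u⁻¹ * r⁻¹ ∈ Q := by
    have : u * (r * u⁻¹ * r⁻¹) ∈ Q :=
      Q.mul_mem htQ (Subgroup.Normal.conj_mem inferInstance _ (Q.inv_mem htQ) r)
    simpa [mul_assoc] using this
  have h1 : u * r * u⁻¹ * r⁻¹ = 1 := by
    obtain ⟨e, he⟩ := isPGroup_iff_pow_pow_eq_one.mp hQ2 ⟨_, hcQ⟩
    obtain ⟨f, hf⟩ := isPGroup_iff_pow_pow_eq_one.mp hR3 ⟨_, hcR⟩
    exact pow_two_three (congrArg Subtype.val he) (congrArg Subtype.val hf)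
  have h2 := mul_inv_eq_one.mp h1
  exact (mul_inv_eq_iff_eq_mul.mp h2).symm

/-- The conjugation action on involutions. -/
def involutionHom (G : Type*) [Group G] : G →* Equiv.Perm {g : G // orderOf g = 2} where
  toFun g :=
    { toFun := fun x => ⟨g * x.1 * g⁻¹, by
        have := x.2
        rwa [← MulAut.conj_apply, MulEquiv.orderOf_eq]⟩
      invFun := fun x => ⟨g⁻¹ * x.1 * g, by
        have := x.2
        have h2 : g⁻¹ * x.1 * g = MulAut.conj g⁻¹ x.1 := by simp
        rwa [h2, MulEquiv.orderOf_eq]⟩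
      left_inv := fun x => Subtype.ext (by simp [mul_assoc])
      right_inv := fun x => Subtype.ext (by simp [mul_assoc]) }
  map_one' := by ext; simp
  map_mul' a b := by ext; simp [mul_assoc]

lemma exists_hom (G : Type*) [Group G] (hG : Pertinent G) :
    ∃ φ : G →* Equiv.Perm (Fin 3), (∀ i j, ∃ g, φ g i = j) ∧
      (∀ g x : G, orderOf x = 2 → g * x = x * g → ∃ i, φ g i = i) ∧
      (∀ x : G, φ x = 1 ↔ ∀ y : G, orderOf y = 2 → x * y = y * x) := by
  obtain ⟨hfin, hcard, hconj⟩ := hG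
  have hc : Nat.card {g : G // orderOf g = 2} = 3 := hcard
  have e : {g : G // orderOf g = 2} ≃ Fin 3 := Nat.equivFinOfCardPos (by omega) |>.trans (finCongr hc)
  have hval : ∀ g y, ((involutionHom G g y : {g : G // orderOf g = 2}) : G) = g * y.1 * g⁻¹ :=
    fun g y => rfl
  refine ⟨(e.permCongrHom.toMonoidHom).comp (involutionHom G), ?_, ?_, ?_⟩
  · intro i j
    obtain ⟨g, hg⟩ := isConj_iff.mp (hconj _ _ (e.symm i).2 (e.symm j).2)
    refine ⟨g, ?_⟩
    have : involutionHom G g (e.symm i) = e.symm j := Subtype.ext hg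
    change e (involutionHom G g (e.symm i)) = j
    rw [this]; simp
  · intro g x hx hgx
    refine ⟨e ⟨x, hx⟩, ?_⟩
    change e (involutionHom G g (e.symm (e ⟨x, hx⟩))) = _
    rw [e.symm_apply_apply]
    congr 1
    apply Subtype.ext
    rw [hval]
    exact mul_inv_eq_iff_eq_mul.mpr hgx
  · intro x
    constructor
    · intro h y hy
      have h2 := congrArg (fun σ : Equiv.Perm (Fin 3) => σ (e ⟨y, hy⟩)) h
      change e (involutionHom G x (e.symm (e ⟨y, hy⟩))) = e ⟨y, hy⟩ at h2
      rw [e.symm_apply_apply] at h2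
      have h3 := congrArg Subtype.val (e.injective h2)
      rw [hval] at h3
      exact mul_inv_eq_iff_eq_mul.mp h3
    · intro h
      ext1 i
      change e (involutionHom G x (e.symm i)) = i
      have : involutionHom G x (e.symm i) = e.symm i := by
        apply Subtype.ext
        rw [hval]
        exact mul_inv_eq_iff_eq_mul.mpr (h _ (e.symm i).2)
      rw [this]; simp

theorem stmt_8 (G : Type*) [Group G] (hG : Pertinent G) (n d : ℕ)
    (hcard : Nat.card G = 2 ^ n * d) (hd : Odd d) (hn : 2 ≤ n) : Even n := by
  obtain ⟨φ, htrans, hfixed, hker⟩ := exists_hom G hG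
  obtain ⟨hfin, -, hconj⟩ := hG
  have : Fact (Nat.Prime 2) := ⟨Nat.prime_two⟩
  have hGcard : Nat.card φ.ker * Nat.card φ.range = Nat.card G := by
    rw [← Subgroup.index_ker, Subgroup.card_mul_index]
  -- there is an involution in the kernel
  have hinv : ∃ z : G, orderOf z = 2 ∧ φ z = 1 := by
    by_contra hno
    have hodd : ¬ 2 ∣ Nat.card φ.ker := by
      intro h2
      obtain ⟨z, hz⟩ := exists_prime_orderOf_dvd_card' 2 h2
      exact hno ⟨z, by rw [← hz]; exact Subgroup.orderOf_coe z, z.2⟩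
    have h4 : 2 ^ 2 ∣ Nat.card φ.ker * Nat.card φ.range := by
      rw [hGcard, hcard]
      exact Dvd.dvd.mul_right (pow_dvd_pow 2 hn) d
    have h4' : 2 ^ 2 ∣ Nat.card φ.range :=
      (Nat.Coprime.pow_left 2 ((Nat.prime_two.coprime_iff_not_dvd).mpr hodd)).dvd_of_dvd_mul_left h4
    have h6 := h4'.trans (Subgroup.card_subgroup_dvd_card φ.range)
    rw [Nat.card_perm, Nat.card_fin] at h6
    revert h6; decide
  have hinvker : ∀ x : G, orderOf x = 2 → φ x = 1 := by
    obtain ⟨z, hz, hz1⟩ := hinv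
    intro x hx
    obtain ⟨c, hc⟩ := isConj_iff.mp (hconj z x hz hx)
    rw [← hc]; simp [hz1]
  obtain ⟨g, hg⟩ : ∃ g : G, ∀ i, φ g i ≠ i := by
    obtain ⟨a, ha⟩ := htrans 0 1
    obtain ⟨b, hb⟩ := htrans 0 2
    rcases perm3_fpf _ _ ha hb with h | h | h
    · exact ⟨a, h⟩
    · exact ⟨b, h⟩
    · exact ⟨a * b, by rw [map_mul]; exact h⟩
  -- Sylow subgroup of the kernel
  obtain ⟨P⟩ : Nonempty (Sylow 2 φ.ker) := inferInstance
  have hfr := P.normalizer_sup_eq_top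
  set Q : Subgroup G := (P : Subgroup φ.ker).map φ.ker.subtype with hQdef
  have hQ2 : IsPGroup 2 Q := P.2.map _
  have hQcard : Nat.card Q = Nat.card P :=
    Subgroup.card_map_of_injective φ.ker.subtype_injective
  set N := Subgroup.normalizer (Q : Set G) with hN
  have hQN : Q ≤ N := Subgroup.le_normalizer
  have hlift : ∀ x : G, ∃ y : N, φ y = φ x := by
    intro x
    have hx : x ∈ N ⊔ φ.ker := by rw [hfr]; trivial
    obtain ⟨y, hy, c, hc, rfl⟩ := Subgroup.mem_sup_of_normal_right.mp hx
    exact ⟨⟨y, hy⟩, by rw [map_mul, MonoidHom.mem_ker.mp hc, mul_one]⟩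
  let φN : N →* Equiv.Perm (Fin 3) := φ.comp N.subtype
  let QN : Subgroup N := Q.subgroupOf N
  have : QN.Normal := Subgroup.normal_in_normalizer
  have hfix : ∀ g : N, (∀ i, φN g i ≠ i) → ∀ x ∈ QN, g * x = x * g → x = 1 := by
    intro g hg x hx hgx
    by_contra hx1
    have hxG : (x : G) ≠ 1 := fun h => hx1 (Subtype.ext h)
    have h2 : 2 ∣ orderOf (x : G) := by
      have := hQ2.dvd_orderOf (g := ⟨(x : G), hx⟩) (fun h => hxG (congrArg Subtype.val h))
      rwa [← Subgroup.orderOf_coe] at this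
    have ho : orderOf ((x : G) ^ (orderOf (x : G) / 2)) = 2 :=
      orderOf_pow_orderOf_div (orderOf_pos _).ne' h2
    have hcomm : Commute (g : G) (x : G) := congrArg Subtype.val hgx
    obtain ⟨i, hi⟩ := hfixed g _ ho (hcomm.pow_right _)
    exact hg i hi
  have hQN2 : IsPGroup 2 QN := hQ2.comap_subtype
  have hQmem : ∀ (x : N) (k : ℕ), φN x = 1 → x ^ (2 ^ k) = 1 → x ∈ QN := by
    intro x k hx hk
    let x' : φ.ker := ⟨x, hx⟩
    have hk' : x' ^ (2 ^ k) = 1 := Subtype.ext (congrArg (Subtype.val : N → G) hk)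
    have hxP : x' ∈ P := by
      have hP : IsPGroup 2 (Subgroup.zpowers x') := isPGroup_zpowers_of hk'
      have hle : Subgroup.zpowers x' ≤ Subgroup.normalizer ((P : Subgroup φ.ker) : Set φ.ker) := by
        rw [Subgroup.zpowers_le, Subgroup.mem_normalizer_iff]
        intro y
        have hxN := Subgroup.mem_normalizer_iff.mp x.2 (y : G)
        have hiff : ∀ w : φ.ker, (w : G) ∈ Q ↔ w ∈ (P : Subgroup φ.ker) := by
          intro w
          constructor
          · rintro ⟨w', hw', he⟩
            have : w' = w := Subtype.ext he
            exact this ▸ hw'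
          · intro hw; exact ⟨w, hw, rfl⟩
        have h1 := hiff y
        have h2 := hiff (x' * y * x'⁻¹)
        exact h1.symm.trans (hxN.trans h2)
      have hsup : IsPGroup 2 (Subgroup.zpowers x' ⊔ (P : Subgroup φ.ker) : Subgroup φ.ker) :=
        hP.to_sup_of_normal_right' P.2 hle
      have := P.3 hsup le_sup_right
      change x' ∈ (P : Subgroup φ.ker); rw [← this]
      exact Subgroup.mem_sup_left (Subgroup.mem_zpowers x')
    exact ⟨x', hxP, rfl⟩
  obtain ⟨gN, hgN⟩ := hlift g
  have hgN' : ∀ i, φN gN i ≠ i := by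
    intro i; change φ gN i ≠ i; rw [hgN]; exact hg i
  have hmod := card_mod_three φN QN hfix gN hgN'
  have hQNcard : Nat.card QN = Nat.card Q := Nat.card_congr (Subgroup.subgroupOfEquivOfLe hQN).toEquiv
  have hsign : ∀ s : G, Equiv.Perm.sign (φ s) = 1 := by
    intro s
    by_contra hs
    have hs' := (Int.units_eq_one_or _).resolve_left hs
    obtain ⟨sN, hsN⟩ := hlift s
    obtain ⟨t, ht2, ht⟩ := exists_odd_involution φN QN hQN2 hQmem hfix gN hgN' sN
      (by change Equiv.Perm.sign (φ sN) = -1; rw [hsN]; exact hs')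
    have ht1 : (t : G) ≠ 1 := by
      intro h
      have : t = 1 := Subtype.ext h
      rw [this, map_one, map_one] at ht
      revert ht; decide
    have h1 := hinvker (t : G) (orderOf_eq_prime (congrArg Subtype.val ht2) ht1)
    change Equiv.Perm.sign (φ t) = -1 at ht
    rw [h1, map_one] at ht
    revert ht; decide
  have hrange : ¬ 2 ∣ Nat.card φ.range := by
    have hle : φ.range ≤ alternatingGroup (Fin 3) := by
      rintro _ ⟨s, rfl⟩
      exact Equiv.Perm.mem_alternatingGroup.mpr (hsign s)
    have h := Subgroup.card_dvd_of_le hle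
    have h3 : Nat.card (alternatingGroup (Fin 3)) = 3 := by
      rw [Nat.card_eq_fintype_card]; decide
    rw [h3] at h
    intro h2
    have := h2.trans h
    omega
  obtain ⟨m, hm⟩ := IsPGroup.iff_card.mp P.2
  have hidx := P.not_dvd_index
  have hk : Nat.card P * (P : Subgroup φ.ker).index = Nat.card φ.ker := Subgroup.card_mul_index _
  have hmn : 2 ^ m * ((P : Subgroup φ.ker).index * Nat.card φ.range) = 2 ^ n * d := by
    rw [← hcard, ← hGcard, ← hk, ← hm, mul_assoc]
  have hodd' : ¬ 2 ∣ (P : Subgroup φ.ker).index * Nat.card φ.range :=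
    Nat.prime_two.not_dvd_mul hidx hrange
  have hd' : ¬ 2 ∣ d := hd.not_two_dvd_nat
  have hmneq : m = n := by
    apply le_antisymm
    · have : 2 ^ m ∣ 2 ^ n * d := ⟨_, hmn.symm⟩
      exact (Nat.pow_dvd_pow_iff_le_right (by norm_num)).mp
        ((Nat.Coprime.pow_left m ((Nat.prime_two.coprime_iff_not_dvd).mpr hd')).dvd_of_dvd_mul_right
          this)
    · have : 2 ^ n ∣ 2 ^ m * ((P : Subgroup φ.ker).index * Nat.card φ.range) := ⟨_, hmn⟩
      exact (Nat.pow_dvd_pow_iff_le_right (by norm_num)).mp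
        ((Nat.Coprime.pow_left n
          ((Nat.prime_two.coprime_iff_not_dvd).mpr hodd')).dvd_of_dvd_mul_right this)
  have hfinal : 2 ^ n ≡ 1 [MOD 3] := by
    rw [← hmneq, ← hm]
    rw [hQNcard, hQcard] at hmod
    exact hmod
  by_contra hodd
  obtain ⟨k, rfl⟩ := Nat.not_even_iff_odd.mp hodd
  have h4 : (2 ^ (2 * k)) ≡ 1 [MOD 3] := by
    rw [pow_mul]
    simpa using (show 2 ^ 2 ≡ 1 [MOD 3] by decide).pow k
  have h5 := h4.mul_right 2
  rw [← pow_succ] at h5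
  have := h5.symm.trans hfinal
  revert this; decide
end

section
/- There exists a pertinent group of order n if and only if n ≡ 6 (mod 12) or n = 4^α·m with α ≥ 1 and m ≡ 3 (mod 6). -/
section Forward
variable {G : Type} [Group G]

def Inv3 (G : Type) [Group G] : Type := {g : G // orderOf g = 2}

theorem orderOf_conj2 (g x : G) : orderOf (g * x * g⁻¹) = orderOf x := by
  have := orderOf_injective (MulAut.conj g).toMonoidHom (MulAut.conj g).injective x
  simpa using this

instance : MulAction G (Inv3 G) where
  smul g x := ⟨g * x.1 * g⁻¹, by rw [orderOf_conj2]; exact x.2⟩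
  one_smul x := Subtype.ext (by change 1 * x.1 * 1⁻¹ = x.1; simp)
  mul_smul g h x := Subtype.ext (by
    change (g * h) * x.1 * (g * h)⁻¹ = g * (h * x.1 * h⁻¹) * g⁻¹; group)

theorem Inv3.smul_val (g : G) (x : Inv3 G) : (g • x).1 = g * x.1 * g⁻¹ := rfl

theorem Inv3.smul_eq_iff (g : G) (x : Inv3 G) : g • x = x ↔ g * x.1 = x.1 * g := by
  rw [← mul_inv_eq_iff_eq_mul]
  exact ⟨fun h => congrArg Subtype.val h, fun h => Subtype.ext h⟩

abbrev phi (G : Type) [Group G] : G →* Equiv.Perm (Inv3 G) := MulAction.toPermHom G (Inv3 G)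

theorem exists_invol_pow [Finite G] (h : G) (hh : 2 ∣ orderOf h) :
    ∃ k : ℕ, orderOf (h ^ k) = 2 :=
  ⟨_, orderOf_pow_orderOf_div (orderOf_pos h).ne' hh⟩

theorem three_part [Finite G] {H : Type*} [Group H] (f : G →* H) (g : G) (hg : orderOf (f g) = 3) :
    ∃ m k : ℕ, (g ^ m) ^ (3 ^ k) = 1 ∧ f (g ^ m) ≠ 1 := by
  obtain ⟨k, m, hm, he⟩ := Nat.exists_eq_pow_mul_and_not_dvd (orderOf_pos g).ne' 3 (by norm_num)
  refine ⟨m, k, ?_, ?_⟩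
  · rw [← pow_mul, mul_comm, ← he, pow_orderOf_eq_one]
  · rw [map_pow]
    intro h
    exact hm (hg ▸ orderOf_dvd_of_pow_eq_one h)

theorem fix_mod {α : Type*} [Finite α] (f : Equiv.Perm α) (k : ℕ) (hf : f ^ 3 ^ k = 1) :
    Nat.card α ≡ {x | f x = x}.ncard [MOD 3] := by
  classical
  have := Fintype.ofFinite α
  have h3 : Fact (Nat.Prime 3) := ⟨by norm_num⟩
  have := Equiv.Perm.card_fixedPoints_modEq (α := α) (f := (f : α → α)) (p := 3) (n := k)
    (by
      have h := congrArg (MulAction.toEndHom (M := Equiv.Perm α) (α := α)) hf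
      rw [map_pow, map_one] at h
      exact h)
  rw [← Nat.card_eq_fintype_card, ← Nat.card_eq_fintype_card] at this
  exact this

theorem no_fix [Finite G] (hI : Nat.card (Inv3 G) = 3) (y : G) (k : ℕ) (hy : y ^ 3 ^ k = 1)
    (hne : phi G y ≠ 1) (v : G) (hv : orderOf v = 2) : y * v ≠ v * y := by
  intro hc
  have : Finite (Inv3 G) := Nat.finite_of_card_ne_zero (by omega)
  have h := fix_mod (phi G y) k (by rw [← map_pow, hy, map_one])
  rw [hI] at h
  have hle := Set.ncard_le_card {x | phi G y x = x}
  have hpos : 0 < {x | phi G y x = x}.ncard := by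
    rw [Set.ncard_pos]
    exact ⟨⟨v, hv⟩, (Inv3.smul_eq_iff y ⟨v, hv⟩).2 hc⟩
  have h3 : {x | phi G y x = x}.ncard = Nat.card (Inv3 G) := by
    unfold Nat.ModEq at h; omega
  rw [← Set.ncard_univ] at h3
  have h4 := Set.eq_of_subset_of_ncard_le (Set.subset_univ _) h3.ge
  apply hne
  ext1 x
  have : x ∈ {x | phi G y x = x} := h4 ▸ Set.mem_univ x
  exact this

theorem three_dvd [Finite G] (hI : Nat.card (Inv3 G) = 3)
    (hc : ∀ a b : G, orderOf a = 2 → orderOf b = 2 → IsConj a b) :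
    3 ∣ Nat.card (phi G).range := by
  have : Finite (Inv3 G) := Nat.finite_of_card_ne_zero (by omega)
  have : Nonempty (Inv3 G) := (Nat.card_pos_iff.1 (by omega)).1
  obtain ⟨x⟩ := this
  have : MulAction.IsPretransitive G (Inv3 G) := ⟨fun a b => by
    obtain ⟨c, hc⟩ := isConj_iff.1 (hc a.1 b.1 a.2 b.2)
    exact ⟨c, Subtype.ext hc⟩⟩
  rw [← Subgroup.index_ker, ← hI, ← MulAction.index_stabilizer_of_transitive G x]
  apply Subgroup.index_dvd_of_le
  intro g hg
  have : phi G g = 1 := hg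
  rw [MulAction.mem_stabilizer_iff]
  exact congrArg (fun f => f x) this

/-- In the commuting case all permutations are even. -/
theorem all_even [Finite G] [Fintype (Inv3 G)] [DecidableEq (Inv3 G)]
    (hI : Nat.card (Inv3 G) = 3)
    (hc : ∀ a b : G, orderOf a = 2 → orderOf b = 2 → IsConj a b)
    (hcomm : ∀ a b : G, orderOf a = 2 → orderOf b = 2 → a * b = b * a) (g : G) :
    Equiv.Perm.sign (phi G g) = 1 := by
  by_contra hg
  have h3 : Fact (Nat.Prime 3) := ⟨by norm_num⟩
  set M := (Equiv.Perm.sign.comp (phi G)).ker with hM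
  have hodd : ∀ h : G, ¬ 2 ∣ orderOf h → h ∈ M := by
    intro h hh
    have h1 : (Equiv.Perm.sign (phi G h)) ^ orderOf h = 1 := by
      rw [← map_pow, ← map_pow, pow_orderOf_eq_one, map_one, map_one]
    rcases Int.units_eq_one_or (Equiv.Perm.sign (phi G h)) with h2 | h2
    · exact h2
    · rw [h2, Odd.neg_one_pow (Nat.not_even_iff_odd.1 (by rwa [even_iff_two_dvd]))] at h1
      exact absurd h1 (by decide)
  -- a 3-element acting nontrivially
  obtain ⟨⟨z', hz'⟩, hz⟩ := exists_prime_orderOf_dvd_card' 3 (three_dvd hI hc)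
  rw [Subgroup.orderOf_mk] at hz
  obtain ⟨z, rfl⟩ := MonoidHom.mem_range.1 hz'
  obtain ⟨m, k, hy1, hy2⟩ := three_part _ _ hz
  generalize z ^ m = y at hy1 hy2
  have hyM : y ∈ M := hodd y (fun h => by
    have := (h.trans (orderOf_dvd_of_pow_eq_one hy1))
    have := Nat.Prime.dvd_of_dvd_pow Nat.prime_two this
    omega)
  have hpg : IsPGroup 3 (Subgroup.zpowers (⟨y, hyM⟩ : M)) := by
    apply IsPGroup.of_card_dvd_pow (n := k)
    rw [Nat.card_zpowers]
    apply orderOf_dvd_of_pow_eq_one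
    exact Subtype.ext hy1
  obtain ⟨Q, hQ⟩ := hpg.exists_le_sylow
  have hF := Sylow.normalizer_sup_eq_top Q
  set X : Subgroup G := (Q : Subgroup M).map M.subtype with hX
  have hyX : y ∈ X := ⟨⟨y, hyM⟩, hQ (Subgroup.mem_zpowers _), rfl⟩
  have hXp : IsPGroup 3 X := Q.2.map _
  have hex : ∃ h ∈ Subgroup.normalizer (X : Set G), h ∉ M := by
    by_contra! hcon
    have : M = ⊤ := by
      rw [← hF]; exact (sup_eq_right.2 hcon).symm
    apply hg
    have : g ∈ M := this ▸ Subgroup.mem_top g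
    exact this
  obtain ⟨h, hN, hnM⟩ := hex
  obtain ⟨j, hj⟩ := exists_invol_pow h (by by_contra h'; exact hnM (hodd h h'))
  have hvN := Subgroup.pow_mem _ hN j
  generalize h ^ j = v at hj hvN
  apply no_fix hI y k hy1 hy2 v hj
  have hw : v * y * v⁻¹ * y⁻¹ ∈ X :=
    X.mul_mem ((Subgroup.mem_normalizer_iff.1 hvN y).1 hyX) (X.inv_mem hyX)
  have hvv : v⁻¹ = v := by
    rw [inv_eq_iff_mul_eq_one, ← pow_two, ← hj, pow_orderOf_eq_one]
  have hu : orderOf (y * v * y⁻¹) = 2 := by rw [orderOf_conj2, hj]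
  have hw2 : (v * y * v⁻¹ * y⁻¹) ^ 2 = 1 := by
    have e : v * y * v⁻¹ * y⁻¹ = v * (y * v * y⁻¹) := by rw [hvv]; group
    have hcm : Commute v (y * v * y⁻¹) := hcomm _ _ hj hu
    rw [e, hcm.mul_pow]
    nth_rewrite 1 [← hj]
    rw [pow_orderOf_eq_one, ← hu, pow_orderOf_eq_one, one_mul]
  obtain ⟨i, hi⟩ := hXp ⟨_, hw⟩
  have hi' : (v * y * v⁻¹ * y⁻¹) ^ 3 ^ i = 1 := congrArg Subtype.val hi
  have hone : v * y * v⁻¹ * y⁻¹ = 1 := by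
    rw [← orderOf_eq_one_iff]
    have := Nat.dvd_gcd (orderOf_dvd_of_pow_eq_one hw2) (orderOf_dvd_of_pow_eq_one hi')
    rwa [Nat.Coprime.gcd_eq_one (Nat.Coprime.pow_right i (by norm_num)), Nat.dvd_one] at this
  rw [mul_inv_eq_one, mul_inv_eq_iff_eq_mul] at hone
  exact hone.symm

theorem even_exp (k : ℕ) (h : 2 ^ k ≡ 1 [MOD 3]) : Even k := by
  by_contra hk
  obtain ⟨j, rfl⟩ := Nat.not_even_iff_odd.1 hk
  have : 2 ^ (2 * j + 1) ≡ 2 [MOD 3] := by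
    rw [pow_succ, pow_mul]
    simpa using ((show 2 ^ 2 ≡ 1 [MOD 3] by decide).pow j).mul_right 2
  exact absurd (this.symm.trans h) (by decide)

theorem forward_comm [Finite G] (hI : Nat.card (Inv3 G) = 3)
    (hc : ∀ a b : G, orderOf a = 2 → orderOf b = 2 → IsConj a b)
    (hcomm : ∀ a b : G, orderOf a = 2 → orderOf b = 2 → a * b = b * a) :
    ∃ α m : ℕ, 1 ≤ α ∧ m % 6 = 3 ∧ Nat.card G = 4 ^ α * m := by
  classical
  have : Finite (Inv3 G) := Nat.finite_of_card_ne_zero (by omega)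
  have : Fintype (Inv3 G) := Fintype.ofFinite _
  have h2 : Fact (Nat.Prime 2) := ⟨by norm_num⟩
  have hev := all_even hI hc hcomm
  have hr : Nat.card (phi G).range = 3 := by
    apply Nat.dvd_antisymm _ (three_dvd hI hc)
    have : Nontrivial (Inv3 G) := Finite.one_lt_card_iff_nontrivial.1 (by omega)
    have hle : (phi G).range ≤ alternatingGroup (Inv3 G) := by
      rintro _ ⟨g, rfl⟩
      exact Equiv.Perm.mem_alternatingGroup.2 (hev g)
    have := Subgroup.card_dvd_of_le hle
    rw [nat_card_alternatingGroup, hI] at this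
    exact this
  have : Nonempty (Inv3 G) := (Nat.card_pos_iff.1 (by omega)).1
  obtain ⟨x⟩ := this
  set K := (phi G).ker with hK
  have hidx : K.index = 3 := by rw [hK, Subgroup.index_ker, hr]
  obtain ⟨P⟩ : Nonempty (Sylow 2 K) := inferInstance
  have hF := Sylow.normalizer_sup_eq_top P
  have hPK : Nat.card ((P : Subgroup K).map K.subtype) = Nat.card P :=
    Subgroup.card_map_of_injective K.subtype_injective
  set R : Subgroup G := (P : Subgroup K).map K.subtype with hR
  have hRp : IsPGroup 2 R := P.2.map _
  have hex : ∃ h ∈ Subgroup.normalizer (R : Set G), h ∉ K := by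
    by_contra! hcon
    have : K = ⊤ := by
      rw [← hF]; exact (sup_eq_right.2 hcon).symm
    rw [this, Subgroup.index_top] at hidx
    omega
  obtain ⟨h, hN, hnK⟩ := hex
  have ho : orderOf (phi G h) = 3 := by
    have h1 : orderOf (phi G h) ∣ 3 := by
      rw [← hr, ← Subgroup.orderOf_mk (phi G h) (MonoidHom.mem_range.2 ⟨h, rfl⟩)]
      exact orderOf_dvd_natCard _
    rcases (Nat.dvd_prime (by norm_num)).1 h1 with h2 | h2
    · exact absurd (orderOf_eq_one_iff.1 h2) hnK
    · exact h2
  obtain ⟨m, k, hy1, hy2⟩ := three_part _ _ ho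
  have hyN := Subgroup.pow_mem _ hN m
  generalize h ^ m = y at hy1 hy2 hyN
  have hfix := fix_mod (MulAut.toPerm R (Subgroup.normalizerMonoidHom R ⟨y, hyN⟩)) k (by
    rw [← map_pow, ← map_pow]
    have : (⟨y, hyN⟩ : Subgroup.normalizer (R : Set G)) ^ 3 ^ k = 1 := Subtype.ext hy1
    rw [this, map_one, map_one])
  have hset : {x | MulAut.toPerm R (Subgroup.normalizerMonoidHom R ⟨y, hyN⟩) x = x} = {1} := by
    ext p
    simp only [Set.mem_ofPred_eq, Set.mem_singleton_iff]
    refine ⟨fun hp => ?_, fun hp => by rw [hp]; exact map_one (Subgroup.normalizerMonoidHom R ⟨y, hyN⟩)⟩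
    have hp' : y * p.1 * y⁻¹ = p.1 := congrArg Subtype.val hp
    have hcm : Commute y p.1 := mul_inv_eq_iff_eq_mul.1 hp'
    by_contra hne
    have hdvd : 2 ∣ orderOf p.1 := by
      obtain ⟨i, hi⟩ := IsPGroup.iff_orderOf.1 hRp p
      rw [Subgroup.orderOf_coe, hi]
      apply dvd_pow_self
      rintro rfl
      rw [pow_zero, orderOf_eq_one_iff] at hi
      exact hne hi
    obtain ⟨j, hj⟩ := exists_invol_pow p.1 hdvd
    exact no_fix hI y k hy1 hy2 _ hj (hcm.pow_right j)
  rw [hset, Set.ncard_singleton, hPK] at hfix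
  obtain ⟨e, he⟩ := IsPGroup.iff_card.1 P.2
  rw [he] at hfix
  obtain ⟨α, hα⟩ := even_exp e hfix
  have hxK : x.1 ∈ K := by
    change phi G x.1 = 1
    ext1 z
    exact (Inv3.smul_eq_iff x.1 z).2 (hcomm _ _ x.2 z.2)
  have h2K : 2 ∣ Nat.card K := by
    have := orderOf_dvd_natCard (⟨x.1, hxK⟩ : K)
    rwa [Subgroup.orderOf_mk, x.2] at this
  have hni := P.not_dvd_index
  have hcK : Nat.card P * (P : Subgroup K).index = Nat.card K := Subgroup.card_mul_index _
  have hcG := K.card_mul_index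
  rw [hidx] at hcG
  refine ⟨α, (P : Subgroup K).index * 3, ?_, by omega, ?_⟩
  · by_contra h0
    obtain rfl : α = 0 := by omega
    have : e = 0 := by omega
    rw [he, this, pow_zero, one_mul] at hcK
    rw [← hcK] at h2K
    exact hni h2K
  · rw [← hcG, ← hcK, he, hα, ← two_mul, pow_mul]
    norm_num [mul_assoc]

theorem forward [Finite G] (hI : Nat.card (Inv3 G) = 3)
    (hc : ∀ a b : G, orderOf a = 2 → orderOf b = 2 → IsConj a b) :
    Nat.card G % 12 = 6 ∨ ∃ α m : ℕ, 1 ≤ α ∧ m % 6 = 3 ∧ Nat.card G = 4 ^ α * m := by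
  have : Finite (Inv3 G) := Nat.finite_of_card_ne_zero (by omega)
  have h2 : Fact (Nat.Prime 2) := ⟨by norm_num⟩
  by_cases hK : 2 ∣ Nat.card (phi G).ker
  · right
    apply forward_comm hI hc
    obtain ⟨⟨z, hzK⟩, hz⟩ := exists_prime_orderOf_dvd_card' 2 hK
    rw [Subgroup.orderOf_mk] at hz
    have hzc : ∀ b : G, orderOf b = 2 → z * b = b * z := by
      intro b hb
      have h1 : phi G z = 1 := hzK
      exact (Inv3.smul_eq_iff z ⟨b, hb⟩).1 (congrArg (fun f => f ⟨b, hb⟩) h1)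
    intro a b ha hb
    obtain ⟨g, rfl⟩ := isConj_iff.1 (hc z a hz ha)
    have h1 := hzc (g⁻¹ * b * g⁻¹⁻¹) (by rw [orderOf_conj2, hb])
    have h2 := congrArg (fun t => g * t * g⁻¹) h1
    simpa [mul_assoc] using h2
  · left
    have h3 := three_dvd hI hc
    have h6 : Nat.card (phi G).range ∣ 6 := by
      have := Subgroup.card_subgroup_dvd_card (phi G).range
      rwa [Nat.card_perm, hI] at this
    have hG := (phi G).ker.card_mul_index
    rw [Subgroup.index_ker] at hG
    have : Nonempty (Inv3 G) := (Nat.card_pos_iff.1 (by omega)).1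
    obtain ⟨x⟩ := this
    have hxG : 2 ∣ Nat.card G := by rw [← x.2]; exact orderOf_dvd_natCard _
    generalize Nat.card (phi G).range = r at *
    have hr : r = 3 ∨ r = 6 := by
      have := Nat.le_of_dvd (by norm_num) h6
      interval_cases r <;> omega
    rcases hr with rfl | rfl <;> omega

end Forward

section Backward

theorem pertinent_of_sq {G : Type} [Group G] [Finite G] (a b c : G) (hab : a ≠ b) (hac : a ≠ c)
    (hbc : b ≠ c) (h : ∀ g : G, orderOf g = 2 ↔ g = a ∨ g = b ∨ g = c)
    (h1 : IsConj a b) (h2 : IsConj b c) : Pertinent G := by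
  refine ⟨inferInstance, ?_, ?_⟩
  · have : {g : G | orderOf g = 2} = {a, b, c} := by
      ext g; simpa using h g
    rw [this, Set.ncard_eq_three]
    exact ⟨a, b, c, hab, hac, hbc, rfl⟩
  · have h3 := h1.trans h2
    intro x y hx hy
    rcases (h x).1 hx with rfl | rfl | rfl <;> rcases (h y).1 hy with rfl | rfl | rfl <;>
      first
        | exact IsConj.refl _
        | assumption
        | (apply IsConj.symm; assumption)

theorem pertinent_prod {H C : Type} [Group H] [Group C] [Finite C] (hH : Pertinent H)
    (hC : Odd (Nat.card C)) : Pertinent (H × C) := by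
  obtain ⟨hf, hn, hc⟩ := hH
  have key : ∀ g : H × C, orderOf g = 2 ↔ orderOf g.1 = 2 ∧ g.2 = 1 := by
    rintro ⟨h, c⟩
    have hco : Odd (orderOf c) := hC.of_dvd_nat (orderOf_dvd_natCard c)
    rw [Prod.orderOf_mk]
    constructor
    · intro hl
      have h1 : orderOf c ∣ 2 := hl ▸ Nat.dvd_lcm_right _ _
      have h2 : orderOf c = 1 := by
        rcases (Nat.dvd_prime Nat.prime_two).1 h1 with h | h
        · exact h
        · rw [h] at hco; exact absurd hco (by decide)
      rw [h2, Nat.lcm_one_right] at hl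
      exact ⟨hl, orderOf_eq_one_iff.1 h2⟩
    · rintro ⟨h1, h2⟩
      simp only at h1 h2
      rw [h1, h2]; simp
  refine ⟨inferInstance, ?_, ?_⟩
  · have : {g : H × C | orderOf g = 2} = Set.image (fun h => (h, 1)) {g : H | orderOf g = 2} := by
      ext ⟨h, c⟩
      simp only [Set.mem_ofPred_eq, key, Set.mem_image, Prod.mk.injEq]
      constructor
      · rintro ⟨h1, rfl⟩; exact ⟨h, h1, rfl, rfl⟩
      · rintro ⟨_, h1, rfl, rfl⟩; exact ⟨h1, rfl⟩
    rw [this, Set.ncard_image_of_injective _ (fun x y hxy => (Prod.mk.inj hxy).1), hn]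
  · rintro ⟨a, a'⟩ ⟨b, b'⟩ ha hb
    obtain ⟨ha, rfl⟩ := (key _).1 ha
    obtain ⟨hb2, hb'⟩ := (key _).1 hb
    simp only at ha hb2 hb'
    subst hb'
    obtain ⟨g, hg⟩ := isConj_iff.1 (hc a b ha hb2)
    exact isConj_iff.2 ⟨(g, 1), by simp [hg]⟩

theorem orderOf_two_iff {G : Type} [Group G] (g : G) : orderOf g = 2 ↔ g ^ 2 = 1 ∧ g ≠ 1 :=
  ⟨fun h => ⟨h ▸ pow_orderOf_eq_one g, fun h' => by simp [h'] at h⟩,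
    fun h => orderOf_eq_prime h.1 h.2⟩

theorem pertinent_S3 : Pertinent (Equiv.Perm (Fin 3)) := by
  apply pertinent_of_sq (Equiv.swap 0 1) (Equiv.swap 0 2) (Equiv.swap 1 2)
  · decide
  · decide
  · decide
  · intro g
    rw [orderOf_two_iff]
    revert g
    decide
  · exact isConj_iff.2 (by decide)
  · exact isConj_iff.2 (by decide)

abbrev AA (N : ℕ) := Multiplicative (ZMod N × ZMod N)

def rot (N : ℕ) : MulAut (AA N) := AddEquiv.toMultiplicative
  { toFun := fun p => (-p.2, p.1 - p.2)
    invFun := fun p => (p.2 - p.1, -p.1)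
    left_inv := fun p => by ext <;> simp
    right_inv := fun p => by ext <;> simp
    map_add' := fun p q => by ext <;> simp <;> ring }

theorem rot_apply (N : ℕ) (x y : ZMod N) :
    rot N (Multiplicative.ofAdd (x, y)) = Multiplicative.ofAdd (-y, x - y) := rfl

theorem rot_cube (N : ℕ) : rot N ^ 3 = 1 := by
  ext1 p
  obtain ⟨⟨x, y⟩, rfl⟩ := Multiplicative.ofAdd.surjective p
  simp only [pow_succ, pow_zero, one_mul, MulAut.mul_apply, rot_apply, MulAut.one_apply]
  congr 2 <;> ring

theorem two_mul_zero (β : ℕ) (x : ZMod (2 ^ (β + 1))) :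
    x + x = 0 ↔ x = 0 ∨ x = ((2 ^ β : ℕ) : ZMod (2 ^ (β + 1))) := by
  obtain ⟨n, rfl⟩ := ZMod.natCast_zmod_surjective x
  rw [← Nat.cast_add, ZMod.natCast_eq_zero_iff, ZMod.natCast_eq_zero_iff, pow_succ, ← mul_two,
    Nat.mul_dvd_mul_iff_right two_pos]
  constructor
  · rintro ⟨t, rfl⟩
    rcases Nat.even_or_odd' t with ⟨s, rfl | rfl⟩
    · left; exact ⟨s, by ring⟩
    · right
      rw [ZMod.natCast_eq_natCast_iff]
      have : 2 ^ β * (2 * s + 1) = 2 ^ β + 2 ^ β * 2 * s := by ring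
      rw [this]
      simp [Nat.ModEq]
  · rintro (h | h)
    · exact (Dvd.intro _ rfl).trans h
    · rw [ZMod.natCast_eq_natCast_iff] at h
      have h' := h.of_mul_right 2
      exact (h'.dvd_iff (dvd_refl _)).2 (dvd_refl _)

theorem half_ne (β : ℕ) : ((2 ^ β : ℕ) : ZMod (2 ^ (β + 1))) ≠ 0 := by
  rw [Ne, ZMod.natCast_eq_zero_iff]
  intro h
  have := Nat.le_of_dvd (by positivity) h
  rw [pow_succ] at this
  have : 0 < 2 ^ β := by positivity
  omega

abbrev HH (N : ℕ) := AA N ⋊[(Subgroup.zpowers (rot N)).subtype] (Subgroup.zpowers (rot N))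

theorem rot_order (β : ℕ) : orderOf (rot (2 ^ (β + 1))) = 3 := by
  have : Fact (Nat.Prime 3) := ⟨by norm_num⟩
  apply orderOf_eq_prime (rot_cube _)
  intro h
  have h1 := congrArg (fun f => f (Multiplicative.ofAdd
    ((((2 ^ β : ℕ) : ZMod (2 ^ (β + 1))), (0 : ZMod (2 ^ (β + 1))))))) h
  simp only [rot_apply, MulAut.one_apply] at h1
  have h2 := congrArg (fun p => (Multiplicative.toAdd p).2) h1
  simp only [toAdd_ofAdd, sub_zero] at h2
  exact half_ne β h2

theorem card_HH (β : ℕ) : Nat.card (HH (2 ^ (β + 1))) = 4 ^ (β + 1) * 3 := by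
  rw [SemidirectProduct.card, Nat.card_zpowers, rot_order]
  have : Nat.card (AA (2 ^ (β + 1))) = Nat.card (ZMod (2 ^ (β + 1)) × ZMod (2 ^ (β + 1))) := rfl
  rw [this, Nat.card_prod, Nat.card_zmod, ← mul_pow]
  norm_num

theorem pertinent_HH (β : ℕ) : Pertinent (HH (2 ^ (β + 1))) := by
  have hfin : Finite (HH (2 ^ (β + 1))) := Nat.finite_of_card_ne_zero (by
    rw [card_HH]; positivity)
  set N := 2 ^ (β + 1) with hN
  obtain ⟨e, he⟩ : ∃ e : ZMod N, e = ((2 ^ β : ℕ) : ZMod N) := ⟨_, rfl⟩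
  have h2 : ∀ x : ZMod N, x + x = 0 ↔ x = 0 ∨ x = e := by
    rw [he]; exact two_mul_zero β
  have hne : e ≠ 0 := by rw [he]; exact half_ne β
  have hee : e + e = 0 := (h2 e).2 (Or.inr rfl)
  have hneg : -e = e := neg_eq_of_add_eq_zero_left hee
  let i : ZMod N × ZMod N → HH N := fun p => SemidirectProduct.inl (Multiplicative.ofAdd p)
  have hi : Function.Injective i :=
    SemidirectProduct.inl_injective.comp Multiplicative.ofAdd.injective
  have hi1 : i 0 = 1 := map_one SemidirectProduct.inl
  let r : HH N := SemidirectProduct.inr ⟨rot N, Subgroup.mem_zpowers _⟩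
  have hr : ∀ x y, r * i (x, y) * r⁻¹ = i (-y, x - y) := by
    intro x y
    have := SemidirectProduct.inl_aut (φ := (Subgroup.zpowers (rot N)).subtype)
      ⟨rot N, Subgroup.mem_zpowers _⟩ (Multiplicative.ofAdd (x, y))
    rw [map_inv] at this
    exact this.symm
  apply pertinent_of_sq (i (e, 0)) (i (0, e)) (i (e, e))
  · exact fun h => hne (Prod.mk.inj (hi h)).1
  · exact fun h => hne (Prod.mk.inj (hi h)).2.symm
  · exact fun h => hne (Prod.mk.inj (hi h)).1.symm
  · intro g
    rw [orderOf_two_iff]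
    have hsq : ∀ x y, i (x, y) ^ 2 = 1 ↔ x + x = 0 ∧ y + y = 0 := by
      intro x y
      have : i (x, y) ^ 2 = i (x + x, y + y) := by
        rw [pow_two]; exact (map_mul SemidirectProduct.inl _ _).symm
      rw [this, ← hi1, hi.eq_iff]
      simp [Prod.ext_iff]
    constructor
    · rintro ⟨hg, hg1⟩
      have hgr : g.right = 1 := by
        have h1 : g.right ^ 2 = 1 := by
          have := congrArg (SemidirectProduct.rightHom (φ := (Subgroup.zpowers (rot N)).subtype)) hg
          rwa [map_pow, map_one] at this
        have h3 : orderOf g.right ∣ 3 := by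
          rw [← rot_order β, ← Nat.card_zpowers (rot (2 ^ (β + 1)))]
          exact orderOf_dvd_natCard g.right
        have := Nat.dvd_gcd (orderOf_dvd_of_pow_eq_one h1) h3
        exact orderOf_eq_one_iff.1 (Nat.dvd_one.1 this)
      have hgi : g = i (Multiplicative.toAdd g.left) := by
        apply SemidirectProduct.ext
        · rfl
        · exact hgr
      generalize Multiplicative.toAdd g.left = p at hgi
      obtain ⟨x, y⟩ := p
      subst hgi
      rw [hsq, h2, h2] at hg
      rcases hg with ⟨rfl | rfl, rfl | rfl⟩
      · exact absurd hi1 hg1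
      · simp
      · simp
      · simp
    · have hz : (0 : ZMod N) + 0 = 0 := add_zero 0
      rintro (rfl | rfl | rfl) <;> refine ⟨(hsq _ _).2 (by simp [hee]), ?_⟩ <;> rw [← hi1] <;>
        intro h <;> have h := hi h <;> simp [Prod.ext_iff, hne] at h
  · exact isConj_iff.2 ⟨r, by rw [hr]; simp⟩
  · exact isConj_iff.2 ⟨r, by rw [hr]; simp [hneg]⟩

theorem backward {H : Type} [Group H] (hH : Pertinent H) (k : ℕ) (hk : Odd k) :
    ∃ (G : Type) (inst : Group G), @Pertinent G inst ∧ Nat.card G = Nat.card H * k := by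
  have : NeZero k := ⟨by rintro rfl; exact absurd hk (by decide)⟩
  have hc : Nat.card (Multiplicative (ZMod k)) = k := Nat.card_zmod k
  exact ⟨H × Multiplicative (ZMod k), inferInstance, pertinent_prod hH (by rwa [hc]), by
    rw [Nat.card_prod, hc]⟩

end Backward

theorem stmt_12 (n : ℕ) :
    (∃ (G : Type) (inst : Group G), @Pertinent G inst ∧ Nat.card G = n) ↔
    (n % 12 = 6 ∨ ∃ α m : ℕ, 1 ≤ α ∧ m % 6 = 3 ∧ n = 4 ^ α * m) := by
  constructor
  · rintro ⟨G, inst, ⟨hf, h3, hc⟩, rfl⟩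
    exact forward h3 hc
  · rintro (h | ⟨α, m, hα, hm, rfl⟩)
    · obtain ⟨G, inst, hG, hcard⟩ := backward pertinent_S3 (n / 6) (by rw [Nat.odd_iff]; omega)
      refine ⟨G, inst, hG, ?_⟩
      rw [hcard, Nat.card_perm, Nat.card_fin]
      simp [Nat.factorial]
      omega
    · obtain ⟨β, rfl⟩ : ∃ β, α = β + 1 := ⟨α - 1, by omega⟩
      obtain ⟨G, inst, hG, hcard⟩ := backward (pertinent_HH β) (m / 3) (by rw [Nat.odd_iff]; omega)
      refine ⟨G, inst, hG, ?_⟩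
      rw [hcard, card_HH, mul_assoc]
      congr 1
      omega
end
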